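/- arXiv:2406.13892 — 2 statements merged into one kernel-verified Lean document; each statement's English description precedes it below -/
import Mathlib

section
/- Fix n ≥ 1, finite types Z and Σ, HMM parameters π, A, B, and a DFA M = (Q, Σ, δ, q₀, F). With α_t and g_t defined as the forward and acceptance quantities of the HMM with respect to M, for every observed prefix x₁, …, x_t ∈ Σ the total acceptance-constrained prefix weight p(S_n ∈ F, x₁:ₜ) — i.e., the sum over all full sequences (x'₁:ₙ, z'₁:ₙ) with x'₁:ₜ = x₁:ₜ and M accepting x'₁:ₙ of p(x'₁:ₙ, z'₁:ₙ) — equals Σ_{z ∈ Z} α_t(z) · g_t(z, s_t), where s_t is the state reached by M from q₀ on reading x₁…x_t. -/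
open scoped NNReal

/-- The forward quantity `α_{t+1}(z)` of an HMM (`0`-based token indexing: `x 0` is `x₁`). -/
noncomputable def fwd {Z σ : Type} [Fintype Z] [DecidableEq Z]
    (π : Z → ℝ≥0) (A : Z → Z → ℝ≥0) (B : Z → σ → ℝ≥0) (x : ℕ → σ)
    (t : ℕ) (z : Z) : ℝ≥0 :=
  ∑ zs : Fin (t + 1) → Z,
    if zs (Fin.last t) = z then
      π (zs 0) * B (zs 0) (x 0) *
        ∏ u : Fin t, A (zs u.castSucc) (zs u.succ) * B (zs u.succ) (x (u.val + 1))
    else 0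

/-- The joint HMM weight `p(x₁:ₙ, z₁:ₙ) = π(z₁)·B(z₁,x₁)·∏_{u=2}^{n} A(z_{u-1},z_u)·B(z_u,x_u)`
of a full hidden sequence `zs` together with the observations `xs` (`0`-based indexing). -/
noncomputable def joint {Z σ : Type}
    (π : Z → ℝ≥0) (A : Z → Z → ℝ≥0) (B : Z → σ → ℝ≥0)
    (n : ℕ) (xs : Fin n → σ) (zs : Fin n → Z) : ℝ≥0 :=
  ∏ u : Fin n,
    (if _ : u.val = 0 then π (zs u)
      else A (zs ⟨u.val - 1, lt_of_le_of_lt (Nat.sub_le _ _) u.isLt⟩) (zs u))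
      * B (zs u) (xs u)

/-- The acceptance quantity `g_t(z, s)` of an HMM with respect to a DFA `M` and horizon `n`
(`1`-based `t`): the sum, over all continuation token sequences `x_{t+1}, …, x_n` such that
running `M` from the state `s` on `x_{t+1} … x_n` ends in an accept state, of the sum over
all hidden continuations `z_{t+1}, …, z_n` of `∏_{u=t+1}^{n} A(z_{u-1}, z_u)·B(z_u, x_u)`
where `z_t = z`.  In particular `accQ A B M n n z s` is `1` if `s ∈ M.accept` and `0`
otherwise. -/
noncomputable def accQ {Z σ Q : Type} [Fintype Z] [Fintype σ]
    (A : Z → Z → ℝ≥0) (B : Z → σ → ℝ≥0) (M : DFA σ Q) [DecidablePred (· ∈ M.accept)]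
    (n t : ℕ) (z : Z) (s : Q) : ℝ≥0 :=
  ∑ xs : Fin (n - t) → σ, ∑ zs : Fin (n - t) → Z,
    if M.evalFrom s (List.ofFn xs) ∈ M.accept then
      ∏ u : Fin (n - t),
        A (if _ : u.val = 0 then z
            else zs ⟨u.val - 1, lt_of_le_of_lt (Nat.sub_le _ _) u.isLt⟩) (zs u)
          * B (zs u) (xs u)
    else 0

lemma accQ_add {Z σ Q : Type} [Fintype Z] [Fintype σ]
    (A : Z → Z → ℝ≥0) (B : Z → σ → ℝ≥0) (M : DFA σ Q) [DecidablePred (· ∈ M.accept)]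
    (m t : ℕ) (z : Z) (s : Q) :
    accQ A B M (t + m) t z s =
  ∑ xs : Fin m → σ, ∑ zs : Fin m → Z,
    if M.evalFrom s (List.ofFn xs) ∈ M.accept then
      ∏ u : Fin m,
        A (if _ : u.val = 0 then z
            else zs ⟨u.val - 1, lt_of_le_of_lt (Nat.sub_le _ _) u.isLt⟩) (zs u)
          * B (zs u) (xs u)
    else 0 := by
  obtain ⟨n, hn⟩ : ∃ n, n = t + m := ⟨_, rfl⟩
  rw [← hn]
  obtain rfl : m = n - t := by omega
  rfl

lemma sum_append {α : Type} [Fintype α] (a b : ℕ) (f : (Fin (a + b) → α) → ℝ≥0) :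
    ∑ v : Fin (a + b) → α, f v =
      ∑ p : Fin a → α, ∑ q : Fin b → α, f (Fin.append p q) := by
  rw [← Fintype.sum_prod_type' (f := fun p q => f (Fin.append p q))]
  exact (Fintype.sum_equiv (Fin.appendEquiv a b) _ _ (fun _ => rfl)).symm

lemma joint_append {Z σ : Type}
    (π : Z → ℝ≥0) (A : Z → Z → ℝ≥0) (B : Z → σ → ℝ≥0)
    (k m : ℕ) (a : Fin (k + 1) → σ) (b : Fin m → σ) (c : Fin (k + 1) → Z) (d : Fin m → Z) :
    joint π A B (k + 1 + m) (Fin.append a b) (Fin.append c d) =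
      (π (c 0) * B (c 0) (a 0) *
        ∏ u : Fin k, A (c u.castSucc) (c u.succ) * B (c u.succ) (a u.succ)) *
      ∏ u : Fin m,
        A (if _ : u.val = 0 then c (Fin.last k)
            else d ⟨u.val - 1, lt_of_le_of_lt (Nat.sub_le _ _) u.isLt⟩) (d u)
          * B (d u) (b u) := by
  unfold joint
  rw [Fin.prod_univ_add]
  congr 1
  · rw [Fin.prod_univ_succ]
    congr 1
    · refine Finset.prod_congr rfl fun u _ => ?_
      simp only [Fin.append_left]
      rw [dif_neg (by simp)]
      congr 2
      exact Fin.append_left c d u.castSucc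
  · refine Finset.prod_congr rfl fun u _ => ?_
    simp only [Fin.append_right]
    rw [dif_neg (by simp)]
    congr 2
    split_ifs with h
    · rw [← Fin.append_left c d (Fin.last k)]
      congr 1
      ext; simp [h]
    · rw [← Fin.append_right c d]
      congr 1
      ext; simp; omega

/-- **Acceptance-constrained prefix weight.**
For `1 ≤ t ≤ n` and an observed prefix `x₁, …, x_t` (written `0`-based as
`x 0, …, x (t-1)`): the total acceptance-constrained prefix weight `p(S_n ∈ F, x₁:ₜ)`,
i.e., the sum over all full sequences `(x'₁:ₙ, z'₁:ₙ)` with `x'₁:ₜ = x₁:ₜ` and `M`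
accepting `x'₁:ₙ` of `p(x'₁:ₙ, z'₁:ₙ)`, equals `∑_{z ∈ Z} α_t(z) · g_t(z, s_t)`,
where `s_t` is the state reached by `M` from its start state on reading `x₁ … x_t`. -/
theorem hmm_dfa_prefix_weight {Z σ Q : Type}
    [Fintype Z] [DecidableEq Z] [Fintype σ] [DecidableEq σ]
    (n : ℕ) (hn : 1 ≤ n)
    (π : Z → ℝ≥0) (A : Z → Z → ℝ≥0) (B : Z → σ → ℝ≥0)
    (M : DFA σ Q) [DecidablePred (· ∈ M.accept)]
    (x : ℕ → σ) (t : ℕ) (ht1 : 1 ≤ t) (ht2 : t ≤ n) :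
    (∑ xs' : Fin n → σ, ∑ zs' : Fin n → Z,
        if (∀ i : Fin n, i.val < t → xs' i = x i.val) ∧
            M.eval (List.ofFn xs') ∈ M.accept then
          joint π A B n xs' zs'
        else 0)
      = ∑ z : Z, fwd π A B x (t - 1) z *
          accQ A B M n t z (M.eval (List.ofFn fun i : Fin t => x i.val)) := by
  obtain ⟨k, rfl⟩ : ∃ k, t = k + 1 := ⟨t - 1, by omega⟩
  obtain ⟨m, rfl⟩ := Nat.exists_eq_add_of_le ht2
  simp only [accQ_add, Nat.add_sub_cancel]
  have key : ∀ (a : Fin (k + 1) → σ) (b : Fin m → σ),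
      ((∀ i : Fin (k + 1 + m), i.val < k + 1 → Fin.append a b i = x i.val) ∧
        M.eval (List.ofFn (Fin.append a b)) ∈ M.accept) ↔
      (a = (fun i : Fin (k + 1) => x i.val) ∧
        M.evalFrom (M.eval (List.ofFn fun i : Fin (k + 1) => x i.val)) (List.ofFn b)
          ∈ M.accept) := by
    intro a b
    have h1 : (∀ i : Fin (k + 1 + m), i.val < k + 1 → Fin.append a b i = x i.val) ↔
        a = (fun i : Fin (k + 1) => x i.val) := by
      constructor
      · intro h
        funext i
        have := h (Fin.castAdd m i) i.isLt
        rwa [Fin.append_left] at this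
      · rintro rfl i hi
        exact Fin.append_left _ b ⟨i.val, hi⟩
    rw [h1]
    refine and_congr_right ?_
    rintro rfl
    rw [List.ofFn_fin_append, DFA.eval, DFA.evalFrom_of_append]
  rw [sum_append]
  simp only [sum_append (α := Z) (k + 1) m, key, joint_append, ite_and]
  rw [Finset.sum_eq_single (fun i : Fin (k + 1) => x i.val)
    (fun a _ ha => by simp [ha]) (by simp)]
  simp only [if_true, fwd, Finset.sum_mul]
  rw [Finset.sum_comm (s := (Finset.univ : Finset Z))]
  simp only [ite_mul, zero_mul, Finset.sum_ite_eq, Finset.mem_univ, if_true]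
  rw [Finset.sum_comm]
  simp only [Finset.mul_sum, mul_ite, mul_zero]
  rfl
end

section
/- Let Σ be a finite alphabet and let w be a nonempty word over Σ of length ℓ. Then there exists a DFA M over Σ with at most ℓ + 2 states such that: (i) M accepts exactly the strings s over Σ whose first occurrence of w as a contiguous substring ends at the last position of s, i.e., w is a suffix of s and w is not an infix of any proper prefix of s; and (ii) M has a dead state d with δ(q, a) = d for every accept state q of M and every symbol a ∈ Σ (so M satisfies the hypothesis required for efficient DFA concatenation by merging). -/
open Classical in
/-- Length of the longest prefix of `w` that is a suffix of `s`. -/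
noncomputable def kmpB {σ : Type} (w s : List σ) : ℕ :=
  Nat.findGreatest (fun k => w.take k <:+ s) w.length

theorem kmpB_le {σ : Type} (w s : List σ) : kmpB w s ≤ w.length := by
  classical
  exact Nat.findGreatest_le _

theorem kmpB_suffix {σ : Type} (w s : List σ) : w.take (kmpB w s) <:+ s := by
  classical
  exact Nat.findGreatest_spec (P := fun k => w.take k <:+ s) (Nat.zero_le w.length) (by simp)

theorem le_kmpB {σ : Type} (w s : List σ) (k : ℕ) (hk : k ≤ w.length) (h : w.take k <:+ s) :
    k ≤ kmpB w s := by
  classical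
  exact Nat.le_findGreatest (P := fun k => w.take k <:+ s) hk h

theorem kmpB_eq_length {σ : Type} (w s : List σ) : kmpB w s = w.length ↔ w <:+ s := by
  constructor
  · intro h
    have := kmpB_suffix w s
    rwa [h, List.take_length] at this
  · intro h
    exact le_antisymm (kmpB_le w s) (le_kmpB w s _ le_rfl (by simpa using h))

theorem take_suffix_concat {σ : Type} (w s : List σ) (a : σ) (k : ℕ) (hk : k ≤ w.length) :
    w.take k <:+ s ++ [a] ↔ w.take k <:+ w.take (kmpB w s) ++ [a] := by
  cases k with
  | zero => simp
  | succ j =>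
    have hj : j < w.length := hk
    have key : w.take j <:+ s ↔ w.take j <:+ w.take (kmpB w s) := by
      constructor
      · intro h
        have hle := le_kmpB w s j hj.le h
        exact List.suffix_of_suffix_length_le h (kmpB_suffix w s)
          (by simp only [List.length_take]; omega)
      · intro h
        exact h.trans (kmpB_suffix w s)
    rw [List.take_succ_eq_append_getElem hj]
    have gen : ∀ t : List σ, w.take j ++ [w[j]] <:+ t ++ [a] ↔ w[j] = a ∧ w.take j <:+ t := by
      intro t
      rw [← List.reverse_prefix, ← List.reverse_prefix (l₁ := w.take j)]
      rw [List.reverse_append, List.reverse_append, List.reverse_singleton, List.reverse_singleton,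
        List.singleton_append, List.singleton_append, List.cons_prefix_cons]
    rw [gen, gen, key]

theorem kmpB_concat {σ : Type} (w s : List σ) (a : σ) :
    kmpB w (s ++ [a]) = kmpB w (w.take (kmpB w s) ++ [a]) := by
  apply le_antisymm
  · exact le_kmpB _ _ _ (kmpB_le _ _)
      ((take_suffix_concat w s a _ (kmpB_le _ _)).1 (kmpB_suffix _ _))
  · exact le_kmpB _ _ _ (kmpB_le _ _)
      ((take_suffix_concat w s a _ (kmpB_le _ _)).2 (kmpB_suffix _ _))

/-- `w` occurs in a proper prefix of `s`. -/
def kmpBad {σ : Type} (w s : List σ) : Prop := ∃ p : List σ, p <+: s ∧ p ≠ s ∧ w <:+: p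

theorem kmpBad_concat {σ : Type} (w s : List σ) (a : σ) :
    kmpBad w (s ++ [a]) ↔ kmpBad w s ∨ w <:+ s := by
  constructor
  · rintro ⟨p, hp, hne, hwp⟩
    rcases List.prefix_concat_iff.1 hp with h | h
    · exact absurd h (by simpa using hne)
    · obtain ⟨u, v, huv⟩ := hwp.trans h.isInfix
      by_cases hv : v = []
      · subst hv
        exact Or.inr ⟨u, by simpa using huv⟩
      · refine Or.inl ⟨u ++ w, ⟨v, huv⟩, ?_, ⟨u, [], by simp⟩⟩
        intro h'
        rw [← h'] at huv
        simp at huv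
        exact hv huv
  · have hs : w <:+: s → kmpBad w (s ++ [a]) := fun h => ⟨s, ⟨[a], rfl⟩, by simp, h⟩
    rintro (⟨p, hp, -, hwp⟩ | h)
    · exact hs (hwp.trans hp.isInfix)
    · exact hs h.isInfix

/-- The KMP automaton; `none` is the dead state. -/
noncomputable def kmpDFA {σ : Type} (w : List σ) : DFA σ (Option (Fin (w.length + 1))) where
  step q a := match q with
    | none => none
    | some k => if k.1 = w.length then none
        else some ⟨kmpB w (w.take k.1 ++ [a]), Nat.lt_succ_of_le (kmpB_le _ _)⟩
  start := some ⟨kmpB w [], Nat.lt_succ_of_le (kmpB_le _ _)⟩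
  accept := {some (Fin.last _)}

open Classical in
theorem kmpDFA_eval {σ : Type} (w s : List σ) :
    (kmpDFA w).eval s = if kmpBad w s then none
      else some ⟨kmpB w s, Nat.lt_succ_of_le (kmpB_le _ _)⟩ := by
  induction s using List.reverseRecOn with
  | nil =>
    have : ¬ kmpBad w [] := by
      rintro ⟨p, hp, hne, -⟩
      exact hne (List.prefix_nil.1 hp)
    rw [if_neg this]
    rfl
  | append_singleton s a ih =>
    rw [DFA.eval_append_singleton, ih]
    by_cases h : kmpBad w s
    · rw [if_pos h, if_pos ((kmpBad_concat w s a).2 (Or.inl h))]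
      rfl
    · rw [if_neg h]
      by_cases h2 : w <:+ s
      · rw [if_pos ((kmpBad_concat w s a).2 (Or.inr h2))]
        simp [kmpDFA, (kmpB_eq_length w s).2 h2]
      · have h3 : ¬ kmpBad w (s ++ [a]) := by
          rw [kmpBad_concat]; tauto
        rw [if_neg h3]
        have h4 : kmpB w s ≠ w.length := fun e => h2 ((kmpB_eq_length w s).1 e)
        simp [kmpDFA, h4, kmpB_concat w s a]


/-- For any nonempty word `w` over a finite alphabet `σ`, there is a DFA `M` with at most
`w.length + 2` states that (i) accepts exactly the strings `s` whose first occurrence of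
`w` as a contiguous substring ends at the last position of `s` (i.e., `w` is a suffix of
`s` and `w` is not an infix of any proper prefix of `s`), and (ii) has a dead state `d`
with `δ(q, a) = d` for every accept state `q` and every symbol `a`, so that `M` satisfies
the hypothesis required for efficient DFA concatenation by merging. -/
theorem kmp_dfa_first_occurrence_at_end {σ : Type} [Fintype σ] (w : List σ) (hw : w ≠ []) :
    ∃ (Q : Type) (_ : Fintype Q) (M : DFA σ Q) (d : Q),
      Fintype.card Q ≤ w.length + 2 ∧
      M.accepts = {s : List σ | w <:+ s ∧ ∀ p : List σ, p <+: s → p ≠ s → ¬ w <:+: p} ∧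
      d ∉ M.accept ∧ (∀ a : σ, M.step d a = d) ∧
      (∀ q ∈ M.accept, ∀ a : σ, M.step q a = d) := by
  classical
  refine ⟨Option (Fin (w.length + 1)), inferInstance, kmpDFA w, none, by simp, ?_, ?_, ?_, ?_⟩
  · ext s
    rw [DFA.mem_accepts, kmpDFA_eval]
    change _ ↔ (w <:+ s ∧ ∀ p : List σ, p <+: s → p ≠ s → ¬ w <:+: p)
    have hb : (∀ p : List σ, p <+: s → p ≠ s → ¬ w <:+: p) ↔ ¬ kmpBad w s := by
      simp [kmpBad]
    rw [hb, ← kmpB_eq_length]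
    by_cases h : kmpBad w s
    · simp [h, kmpDFA]
    · simp [h, kmpDFA, Fin.ext_iff]
  · simp [kmpDFA]
  · intro a
    rfl
  · intro q hq a
    have : q = some (Fin.last _) := hq
    subst this
    simp [kmpDFA]
end
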